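/- For every natural number n, a set S of vectors v : Fin n → Bool is the set of all vectors satisfying every clause in some finite set of Horn clauses if and only if S is closed under the meet operation, i.e., for all v, w ∈ S the pointwise conjunction v ⊓ w (defined by (v ⊓ w) i = v i && w i) also belongs to S. -/

import Mathlib

/-- A Horn clause: a finite antecedent set together with an optional head
(`some j` for a variable head, `none` for the head `false`). -/
structure HornClause (n : ℕ) where
  ante : Finset (Fin n)
  head : Option (Fin n)
deriving DecidableEq

/-- A vector satisfies a Horn clause iff whenever all antecedent variables
are true, the head is a variable that is true. -/
def SatisfiesClause {n : ℕ} (v : Fin n → Bool) (c : HornClause n) : Prop :=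
  (∀ i ∈ c.ante, v i = true) → ∃ j, c.head = some j ∧ v j = true

instance HornClause.instFinite (n : ℕ) : Finite (HornClause n) :=
  Finite.of_injective (fun c : HornClause n => (c.ante, c.head)) <| by
    rintro ⟨a, h⟩ ⟨b, k⟩ hab
    simpa using hab

/-- Horn clauses are preserved under meets. -/
theorem SatisfiesClause.meet {n : ℕ} {v w : Fin n → Bool} {c : HornClause n}
    (hv : SatisfiesClause v c) (hw : SatisfiesClause w c) :
    SatisfiesClause (fun i => v i && w i) c := by
  intro h
  simp only [Bool.and_eq_true] at h
  obtain ⟨j, hj, hvj⟩ := hv fun i hi => (h i hi).1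
  obtain ⟨k, hk, hwk⟩ := hw fun i hi => (h i hi).2
  obtain rfl : j = k := Option.some.inj (hj.symm.trans hk)
  exact ⟨j, hj, by simp [hvj, hwk]⟩

/-- If `v` satisfies every Horn clause valid on `S`, then any head falsified by `v` is falsified
by some element of `S` above `v`. -/
theorem exists_mem_above_not_head {n : ℕ} {S : Set (Fin n → Bool)} {v : Fin n → Bool}
    (hv : ∀ c : HornClause n, (∀ w ∈ S, SatisfiesClause w c) → SatisfiesClause v c)
    (h : Option (Fin n)) (hh : ∀ j, h = some j → v j = false) :
    ∃ w ∈ S, (∀ i, v i = true → w i = true) ∧ ∀ j, h = some j → w j = false := by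
  by_contra! hS
  obtain ⟨j, hj, hvj⟩ := hv ⟨Finset.univ.filter (v · = true), h⟩
    (fun w hw hante => by simpa using hS w hw (by simpa using hante)) (by simp)
  simp [hh j hj] at hvj

/-- A vector satisfying every Horn clause valid on a meet-closed set belongs to that set. -/
theorem mem_of_satisfies_valid_clauses {n : ℕ} {S : Set (Fin n → Bool)}
    (hS : ∀ v ∈ S, ∀ w ∈ S, (fun i => v i && w i) ∈ S) {v : Fin n → Bool}
    (hv : ∀ c : HornClause n, (∀ w ∈ S, SatisfiesClause w c) → SatisfiesClause v c) :
    v ∈ S := by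
  have key : ∀ J : Finset (Fin n), ∃ w ∈ S, (∀ i, v i = true → w i = true) ∧
      ∀ j ∈ J, v j = false → w j = false := by
    intro J
    induction J using Finset.induction_on with
    | empty =>
      obtain ⟨w, hw, hle, -⟩ := exists_mem_above_not_head hv none (by simp)
      exact ⟨w, hw, hle, by simp⟩
    | insert j J _ ih =>
      obtain ⟨w, hw, hle, hJ⟩ := ih
      by_cases hj : v j = false
      · obtain ⟨u, hu, hle', huj⟩ := exists_mem_above_not_head hv (some j) (by simpa using hj)
        refine ⟨_, hS w hw u hu, fun i hi => by simp [hle i hi, hle' i hi], fun i hi hvi => ?_⟩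
        rcases Finset.mem_insert.1 hi with rfl | hi
        · simp [huj i rfl]
        · simp [hJ i hi hvi]
      · refine ⟨w, hw, hle, fun i hi hvi => ?_⟩
        rcases Finset.mem_insert.1 hi with rfl | hi
        · exact absurd hvi hj
        · exact hJ i hi hvi
  obtain ⟨w, hw, hle, hge⟩ := key Finset.univ
  have hvw : v = w := by
    funext i
    cases hi : v i
    · exact (hge i (Finset.mem_univ i) hi).symm
    · exact (hle i hi).symm
  exact hvw ▸ hw

theorem horn_set_iff_meet_closed (n : ℕ) (S : Set (Fin n → Bool)) :
    (∃ C : Finset (HornClause n),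
        S = {v : Fin n → Bool | ∀ c ∈ C, SatisfiesClause v c}) ↔
      (∀ v ∈ S, ∀ w ∈ S, (fun i => v i && w i) ∈ S) := by
  constructor
  · rintro ⟨C, rfl⟩ v hv w hw c hc
    exact (hv c hc).meet (hw c hc)
  · intro hS
    refine ⟨(Set.toFinite {c : HornClause n | ∀ w ∈ S, SatisfiesClause w c}).toFinset, ?_⟩
    ext v
    simp only [Set.Finite.mem_toFinset, Set.mem_ofPred_eq]
    exact ⟨fun hv c hc => hc v hv, mem_of_satisfies_valid_clauses hS⟩
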